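/- arXiv:1204.2851 — 3 statements merged into one kernel-verified Lean document; each statement's English description precedes it below -/
import Mathlib

section
/- Let M be a finite-dimensional Z₂-vector space carrying an encoded strictly unital right A_∞-module structure over A, i.e. a sequence of Z₂-linear endomorphisms m_i : M → M (i ≥ 0) satisfying Σ_{i+j=k} m_i ∘ m_j = 0 for every k ≥ 0. Then there exist natural numbers r, s and integers k₁, …, k_s ≥ 1 such that, setting N equal to the direct sum of r copies of the trivial one-dimensional module Z₂ (all operators zero) and of the modules R_{k₁}, …, R_{k_s}, there is a strictly unital quasi-isomorphism f = (f_i)_{i ≥ 0} : N → M: a sequence of Z₂-linear maps f_i : N → M satisfying Σ_{i+j=k} f_i ∘ m^N_j = Σ_{i+j=k} m^M_i ∘ f_j for all k ≥ 0, such that f₀ induces an isomorphism ker m^N₀ / im m^N₀ → ker m^M₀ / im m^M₀. The analogous statement holds for left modules, with L_k in place of R_k. -/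
/-- The underlying vector space of a direct sum of `r` copies of the trivial one-dimensional
module `ℤ/2` and `s` two-dimensional modules `R_{k}` (each with basis `r⁰, r¹`). -/
abbrev ModelSpace (r s : ℕ) : Type :=
  (Fin r → ZMod 2) × (Fin s → ZMod 2 × ZMod 2)

open PowerSeries in
/-- Normal form of a square-zero endomorphism of a finite free module over `(ZMod 2)⟦X⟧`. -/
lemma normalForm_aux {V : Type*} [AddCommGroup V] [Module (PowerSeries (ZMod 2)) V]
    [Module.Free (PowerSeries (ZMod 2)) V] [Module.Finite (PowerSeries (ZMod 2)) V]
    (D : V →ₗ[PowerSeries (ZMod 2)] V) (hD : ∀ v, D (D v) = 0) :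
    ∃ (r s : ℕ) (e : Fin s → ℕ) (w : Fin r → V) (c z : Fin s → V),
      (∀ i, D (w i) = 0) ∧ (∀ j, D (z j) = 0) ∧
      (∀ j, D (c j) = (X : PowerSeries (ZMod 2)) ^ e j • z j) ∧
      (∀ v, ∃ (a : Fin r → PowerSeries (ZMod 2)) (b g : Fin s → PowerSeries (ZMod 2)),
        v = ∑ i, a i • w i + ∑ j, (b j • c j + g j • z j)) ∧
      (∀ (a : Fin r → PowerSeries (ZMod 2)) (b g : Fin s → PowerSeries (ZMod 2)),
        ∑ i, a i • w i + ∑ j, (b j • c j + g j • z j) = 0 → a = 0 ∧ b = 0 ∧ g = 0) := by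
  classical
  set K := LinearMap.ker D with hK
  let D' : V →ₗ[PowerSeries (ZMod 2)] K := D.codRestrict K (fun v => by simp [hK, hD])
  have hD' : ∀ v, ((D' v : K) : V) = D v := fun v => rfl
  obtain ⟨s, snf⟩ := Submodule.smithNormalForm
    (Module.Free.chooseBasis (PowerSeries (ZMod 2)) K) (LinearMap.range D')
  have ha : ∀ i, snf.a i ≠ 0 := by
    intro i h
    have h1 := snf.snf i
    rw [h, zero_smul] at h1
    exact snf.bN.ne_zero i (Subtype.ext h1)
  have hu : ∀ i, ∃ (n : ℕ) (u : (PowerSeries (ZMod 2))ˣ),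
      snf.a i = u * (X : PowerSeries (ZMod 2)) ^ n := fun i =>
    IsDiscreteValuationRing.eq_unit_mul_pow_irreducible (ha i) X_prime.irreducible
  choose e u hu using hu
  have hc : ∀ i, ∃ c, D' c = (snf.bN i : K) := fun i => (snf.bN i).2
  choose c hc using hc
  let C := {x // x ∉ Set.range snf.f}
  let _ : Fintype (Module.Free.ChooseBasisIndex (PowerSeries (ZMod 2)) K) := Fintype.ofFinite _
  let eq1 : Fin (Fintype.card C) ⊕ Fin s ≃
      Module.Free.ChooseBasisIndex (PowerSeries (ZMod 2)) K :=
    ((Fintype.equivFin C).symm.sumCongr (Equiv.ofInjective snf.f snf.f.injective)).trans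
      ((Equiv.sumComm _ _).trans (Equiv.Set.sumCompl (Set.range snf.f)))
  let bK := snf.bM.reindex eq1.symm
  have hbK : ∀ j, bK (Sum.inr j) = snf.bM (snf.f j) := by
    intro j
    simp only [bK, eq1, Module.Basis.reindex_apply, Equiv.symm_symm]
    rfl
  have hcz : ∀ j, D (((u j)⁻¹ : (PowerSeries (ZMod 2))ˣ) • c j)
      = (X : PowerSeries (ZMod 2)) ^ e j • (bK (Sum.inr j) : V) := by
    intro j
    have h1 : D (c j) = snf.a j • (bK (Sum.inr j) : V) := by
      rw [← hD', hc, snf.snf, hbK]; rfl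
    rw [Units.smul_def, map_smul, h1, hu, smul_smul, ← mul_assoc, Units.inv_mul, one_mul]
  refine ⟨Fintype.card C, s, e, fun i => bK (Sum.inl i),
    fun j => ((u j)⁻¹ : (PowerSeries (ZMod 2))ˣ) • c j, fun j => bK (Sum.inr j),
    fun i => (bK (Sum.inl i)).2, fun j => (bK (Sum.inr j)).2, hcz, ?_, ?_⟩
  · intro v
    let b0 := snf.bN.repr ⟨D' v, v, rfl⟩
    have h0 : D v = ∑ j, b0 j • D (c j) := by
      have h1 := snf.bN.sum_repr ⟨D' v, v, rfl⟩
      have h2 := congrArg (fun x : LinearMap.range D' => ((x : K) : V)) h1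
      simp only [hD'] at h2
      rw [← h2]
      simp only [Submodule.coe_sum, Submodule.coe_smul, b0, ← hD', hc]
    have h3 : v - ∑ j, b0 j • c j ∈ K := by
      rw [hK, LinearMap.mem_ker, map_sub, h0, map_sum]
      simp
    have h4 := bK.sum_repr ⟨_, h3⟩
    have h5 := congrArg (fun x : K => (x : V)) h4
    simp only [Fintype.sum_sum_type, Submodule.coe_add, Submodule.coe_sum,
      Submodule.coe_smul] at h5
    refine ⟨fun i => bK.repr ⟨_, h3⟩ (Sum.inl i), fun j => b0 j * u j,
      fun j => bK.repr ⟨_, h3⟩ (Sum.inr j), ?_⟩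
    have h6 : ∀ j, (b0 j * (u j : PowerSeries (ZMod 2))) •
        (((u j)⁻¹ : (PowerSeries (ZMod 2))ˣ) • c j) = b0 j • c j := by
      intro j
      rw [Units.smul_def, smul_smul, mul_assoc, Units.mul_inv, mul_one]
    simp only [h6, Finset.sum_add_distrib]
    rw [eq_sub_iff_add_eq] at h5
    refine h5.symm.trans ?_
    abel
  · intro a b g h
    have hli := Fintype.linearIndependent_iff.1 bK.linearIndependent
    have h1 := congrArg D h
    have hb : b = 0 := by
      have h2 : ∑ j, (b j * X ^ e j) • (bK (Sum.inr j) : V) = 0 := by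
        have hz : ∀ x, D (bK x : V) = 0 := fun x => (bK x).2
        simpa only [map_add, map_sum, map_smul, hcz, hz, smul_zero, Finset.sum_const_zero,
          zero_add, add_zero, map_zero, smul_smul] using h1
      have h3 := hli (Sum.elim 0 (fun j => b j * X ^ e j)) (by
        apply Subtype.ext
        simpa [Fintype.sum_sum_type] using h2)
      ext1 j
      have h4 := h3 (Sum.inr j)
      simp only [Sum.elim_inr] at h4
      exact (mul_eq_zero.1 h4).resolve_right (pow_ne_zero _ X_ne_zero)
    subst hb
    have h3 := hli (Sum.elim a g) (by
        apply Subtype.ext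
        simpa [Fintype.sum_sum_type] using h)
    exact ⟨funext fun i => h3 (Sum.inl i), rfl, funext fun i => h3 (Sum.inr i)⟩

open PowerSeries in
/-- The encoded module as a square-zero operator over power series. -/
lemma operator_aux {M : Type*} [AddCommGroup M] [Module (ZMod 2) M]
    [FiniteDimensional (ZMod 2) M]
    (m : ℕ → M →ₗ[ZMod 2] M)
    (hm : ∀ k : ℕ, ∑ i ∈ Finset.range (k + 1), m i ∘ₗ m (k - i) = 0) :
    ∃ (n : ℕ) (cf : ℕ → (Fin n → PowerSeries (ZMod 2)) →ₗ[ZMod 2] M)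
      (D : (Fin n → PowerSeries (ZMod 2)) →ₗ[PowerSeries (ZMod 2)]
        (Fin n → PowerSeries (ZMod 2))),
      (∀ v, D (D v) = 0) ∧
      (∀ k v, cf k (D v) = ∑ i ∈ Finset.range (k + 1), m i (cf (k - i) v)) ∧
      (∀ e k v, cf k ((X : PowerSeries (ZMod 2)) ^ e • v) = if e ≤ k then cf (k - e) v else 0) ∧
      (∀ (p : PowerSeries (ZMod 2)) v, cf 0 (p • v) = constantCoeff p • cf 0 v) ∧
      (∀ y, ∃ v, cf 0 v = y) ∧
      (∀ v, cf 0 v = 0 → ∃ v', v = (X : PowerSeries (ZMod 2)) • v') := by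
  classical
  let ee := (Module.finBasis (ZMod 2) M).equivFun
  let co (k : ℕ) : (Fin (Module.finrank (ZMod 2) M) → PowerSeries (ZMod 2)) →ₗ[ZMod 2]
    (Fin (Module.finrank (ZMod 2) M) → ZMod 2) :=
    LinearMap.pi (fun i => (coeff (R := ZMod 2) k) ∘ₗ LinearMap.proj i)
  let cf (k : ℕ) := ee.symm.toLinearMap ∘ₗ co k
  have hco : ∀ k v i, co k v i = coeff k (v i) := fun _ _ _ => rfl
  have hcf : ∀ k v, ee (cf k v) = co k v := fun k v => by simp [cf]
  let A : Matrix (Fin (Module.finrank (ZMod 2) M)) (Fin (Module.finrank (ZMod 2) M))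
    (PowerSeries (ZMod 2)) := fun i j => PowerSeries.mk fun k => ee (m k (ee.symm (Pi.single j 1))) i
  have hinj : ∀ v v', (∀ k, cf k v = cf k v') → v = v' := by
    intro v v' h
    ext i k
    have := congrFun (congrArg ee (h k)) i
    rwa [hcf, hcf] at this
  have hDc : ∀ k v, cf k (Matrix.toLin' A v)
      = ∑ i ∈ Finset.range (k + 1), m i (cf (k - i) v) := by
    intro k v
    apply ee.injective
    rw [hcf]
    ext i
    have hexp : ∀ (l : ℕ) (y : M), ee (m l y) i
        = ∑ j, ee (m l (ee.symm (Pi.single j 1))) i * ee y j := by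
      intro l y
      conv_lhs => rw [← ee.symm_apply_apply y, pi_eq_sum_univ' (ee y)]
      simp only [map_sum, map_smul, Finset.sum_apply, Pi.smul_apply, smul_eq_mul]
      refine Finset.sum_congr rfl fun j _ => ?_
      rw [mul_comm]
    rw [hco, Matrix.toLin'_apply, Matrix.mulVec, dotProduct, map_sum, map_sum, Finset.sum_apply]
    simp only [hexp _ (cf _ v), hcf, hco]
    rw [Finset.sum_comm]
    refine Finset.sum_congr rfl fun j _ => ?_
    rw [coeff_mul, Finset.Nat.sum_antidiagonal_eq_sum_range_succ_mk]
    simp [A]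
  refine ⟨Module.finrank (ZMod 2) M, cf, Matrix.toLin' A, ?_, hDc, ?_, ?_, ?_, ?_⟩
  · intro v
    apply hinj
    intro k
    rw [hDc, map_zero]
    simp only [hDc, map_sum]
    have h1 : ∀ k', ∑ i ∈ Finset.range (k' + 1), (m i) (m (k' - i) (cf (k - k') v)) = 0 := by
      intro k'
      have := congrArg (fun g => g (cf (k - k') v)) (hm k')
      simpa using this
    rw [← Finset.sum_eq_zero (s := Finset.range (k + 1)) (fun k' _ => h1 k')]
    rw [Finset.sum_sigma', Finset.sum_sigma']
    refine Finset.sum_bij' (fun p _ => ⟨p.1 + p.2, p.1⟩) (fun p _ => ⟨p.2, p.1 - p.2⟩)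
      ?_ ?_ ?_ ?_ ?_
    · rintro ⟨a, b⟩ h; simp at h ⊢; omega
    · rintro ⟨a, b⟩ h; simp at h ⊢; omega
    · rintro ⟨a, b⟩ h; simp
    · rintro ⟨a, b⟩ h; simp at h ⊢; omega
    · rintro ⟨a, b⟩ h; simp [Nat.sub_sub]
  · intro e k v
    apply ee.injective
    ext i
    split_ifs with h
    · rw [hcf, hcf, hco, hco, Pi.smul_apply, smul_eq_mul, coeff_X_pow_mul', if_pos h]
    · rw [hcf, hco, Pi.smul_apply, smul_eq_mul, coeff_X_pow_mul', if_neg h]; simp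
  · intro p v
    apply ee.injective
    ext i
    rw [map_smul ee, hcf, hcf, hco, Pi.smul_apply, Pi.smul_apply, hco]
    simp
  · intro y
    refine ⟨fun i => C (ee y i), ?_⟩
    apply ee.injective
    ext i
    rw [hcf, hco]
    simp
  · intro v hv
    have h : ∀ i, (X : PowerSeries (ZMod 2)) ∣ v i := by
      intro i
      rw [X_dvd_iff]
      have := congrFun (congrArg ee hv) i
      rw [hcf, hco] at this
      simpa using this
    choose v' hv' using h
    exact ⟨v', funext hv'⟩

/-- Classification of finite dimensional strictly unital `A_∞`-modules over
`A = ℤ/2[ε]/(ε²)` (encoded as a sequence of operators `m_i` with `∑_{i+j=k} m_i ∘ m_j = 0`):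
every such module is quasi-isomorphic to a direct sum of `r` copies of the trivial module and
modules `R_{k₁}, …, R_{k_s}` with `k_j ≥ 1`, where `R_k` has basis `r⁰, r¹` and sole nonzero
operator value `m_{k-1}(r⁰) = r¹`.  (Left modules are encoded identically, so this statement
covers the left-module case with `L_k` in place of `R_k` as well.) -/
theorem stmt2 {M : Type*} [AddCommGroup M] [Module (ZMod 2) M]
    [FiniteDimensional (ZMod 2) M]
    (m : ℕ → M →ₗ[ZMod 2] M)
    (hm : ∀ k : ℕ, ∑ i ∈ Finset.range (k + 1), m i ∘ₗ m (k - i) = 0) :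
    ∃ (r s : ℕ) (ks : Fin s → ℕ), (∀ j, 1 ≤ ks j) ∧
      ∃ nOp : ℕ → ModelSpace r s →ₗ[ZMod 2] ModelSpace r s,
        (∀ i x, nOp i x =
          (0, fun j => if i + 1 = ks j then ((0 : ZMod 2), (x.2 j).1) else 0)) ∧
        (∀ k : ℕ, ∑ i ∈ Finset.range (k + 1), nOp i ∘ₗ nOp (k - i) = 0) ∧
        ∃ f : ℕ → ModelSpace r s →ₗ[ZMod 2] M,
          -- `f` is a (strictly unital) morphism of encoded `A_∞`-modules:
          (∀ k : ℕ, ∑ i ∈ Finset.range (k + 1), f i ∘ₗ nOp (k - i)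
              = ∑ i ∈ Finset.range (k + 1), m i ∘ₗ f (k - i)) ∧
          -- `f 0` induces an isomorphism `ker nOp₀ / im nOp₀ ≃ ker m₀ / im m₀`:
          (∀ x, nOp 0 x = 0 → f 0 x ∈ LinearMap.range (m 0) →
            x ∈ LinearMap.range (nOp 0)) ∧
          (∀ y, m 0 y = 0 → ∃ x, nOp 0 x = 0 ∧ y - f 0 x ∈ LinearMap.range (m 0)) := by
  classical
  obtain ⟨n, cf, D, hDD, hDc, hX, h0, hsurj, hdvd⟩ := operator_aux m hm
  obtain ⟨r, s, e, w, c, z, hw, hz, hc, hspan, hind⟩ := normalForm_aux D hDD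
  let nOp : ℕ → ModelSpace r s →ₗ[ZMod 2] ModelSpace r s := fun i =>
    { toFun := fun x => (0, fun j => if i + 1 = e j + 1 then ((0 : ZMod 2), (x.2 j).1) else 0)
      map_add' := by
        intro x y
        ext j
        · simp
        · simp; split_ifs <;> simp
        · simp; split_ifs <;> simp
      map_smul' := by
        intro a x
        ext j
        · simp
        · simp
        · simp }
  have hn : ∀ i x, nOp i x
      = (0, fun j => if i + 1 = e j + 1 then ((0 : ZMod 2), (x.2 j).1) else 0) := fun _ _ => rfl
  let F : ModelSpace r s →ₗ[ZMod 2] (Fin n → PowerSeries (ZMod 2)) :=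
    { toFun := fun x => ∑ i, x.1 i • w i + ∑ j, ((x.2 j).1 • c j + (x.2 j).2 • z j)
      map_add' := by
        intro x y
        simp only [Prod.fst_add, Prod.snd_add, Pi.add_apply, add_smul, Finset.sum_add_distrib]
        abel
      map_smul' := by
        intro a x
        simp only [Prod.smul_fst, Prod.smul_snd, Pi.smul_apply, smul_eq_mul, mul_smul,
          smul_add, Finset.smul_sum, RingHom.id_apply] }
  have hF : ∀ x, F x = ∑ i, x.1 i • w i + ∑ j, ((x.2 j).1 • c j + (x.2 j).2 • z j) :=
    fun _ => rfl
  let f : ℕ → ModelSpace r s →ₗ[ZMod 2] M := fun k => cf k ∘ₗ F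
  have hf : ∀ k x, f k x = cf k (F x) := fun _ _ => rfl
  have hmor : ∀ k : ℕ, ∑ i ∈ Finset.range (k + 1), f i ∘ₗ nOp (k - i)
      = ∑ i ∈ Finset.range (k + 1), m i ∘ₗ f (k - i) := by
    intro k
    refine LinearMap.ext fun x => ?_
    simp only [LinearMap.sum_apply, LinearMap.comp_apply, hf]
    rw [← hDc]
    have hDs : ∀ (a : ZMod 2) v, D (a • v) = a • D v := fun a v => D.map_smul_of_tower a v
    have h1 : D (F x) = ∑ j, (x.2 j).1 • ((PowerSeries.X : PowerSeries (ZMod 2)) ^ e j • z j) := by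
      rw [hF]
      simp only [map_add, map_sum, hDs, hw, hz, hc, smul_zero, Finset.sum_const_zero, zero_add,
        add_zero]
    rw [h1]
    simp only [map_sum, map_smul, hX, hF, hn]
    have h2 : ∀ i, cf i (∑ i' : Fin r, (0 : Fin r → ZMod 2) i' • w i' + ∑ j : Fin s,
        ((if k - i + 1 = e j + 1 then ((0 : ZMod 2), (x.2 j).1) else 0).1 • c j
        + (if k - i + 1 = e j + 1 then ((0 : ZMod 2), (x.2 j).1) else 0).2 • z j))
        = ∑ j, if k - i = e j then (x.2 j).1 • cf i (z j) else 0 := by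
      intro i
      simp only [Pi.zero_apply, zero_smul, Finset.sum_const_zero, zero_add, map_sum]
      refine Finset.sum_congr rfl fun j _ => ?_
      by_cases h : k - i = e j <;> simp [h]
    rw [Finset.sum_congr rfl (fun i _ => h2 i), Finset.sum_comm]
    refine Finset.sum_congr rfl fun j _ => ?_
    split_ifs with h
    · rw [Finset.sum_eq_single (k - e j)]
      · rw [if_pos (by omega)]
      · intro b hb hne
        rw [if_neg]
        simp at hb
        omega
      · intro h'
        simp at h'
    · rw [smul_zero]
      refine Finset.sum_eq_zero fun i _ => ?_
      rw [if_neg (by omega)]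
  have hf0 : ∀ x, f 0 (nOp 0 x) = m 0 (f 0 x) := by
    intro x
    simpa using congrArg (fun g => g x) (hmor 0)
  have hfs : Function.Surjective (f 0) := by
    intro y
    obtain ⟨v, rfl⟩ := hsurj y
    obtain ⟨a, b, g, rfl⟩ := hspan v
    refine ⟨(fun i => PowerSeries.constantCoeff (a i),
      fun j => (PowerSeries.constantCoeff (b j), PowerSeries.constantCoeff (g j))), ?_⟩
    rw [hf, hF]
    simp only [map_add, map_sum, map_smul, h0]
  have hfi : Function.Injective (f 0) := by
    rw [injective_iff_map_eq_zero]
    intro x hx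
    obtain ⟨v', hv'⟩ := hdvd _ hx
    obtain ⟨a, b, g, rfl⟩ := hspan v'
    have hCs : ∀ (a : ZMod 2) (v : Fin n → PowerSeries (ZMod 2)),
        a • v = (PowerSeries.C a) • v := by
      intro a v
      ext i k
      simp
    have h1 := hind (fun i => PowerSeries.C (x.1 i) - PowerSeries.X * a i)
      (fun j => PowerSeries.C (x.2 j).1 - PowerSeries.X * b j)
      (fun j => PowerSeries.C (x.2 j).2 - PowerSeries.X * g j) (by
        rw [hF] at hv'
        simp only [hCs] at hv'
        simp only [sub_smul, mul_smul, Finset.sum_add_distrib, Finset.sum_sub_distrib,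
          smul_add, Finset.smul_sum] at hv' ⊢
        rw [← sub_eq_zero] at hv'
        rw [← hv']
        abel)
    obtain ⟨ha, hb, hg⟩ := h1
    ext j
    · simpa using congrArg PowerSeries.constantCoeff (congrFun ha j)
    · simpa using congrArg PowerSeries.constantCoeff (congrFun hb j)
    · simpa using congrArg PowerSeries.constantCoeff (congrFun hg j)
  refine ⟨r, s, fun j => e j + 1, fun j => by simp, nOp, hn, ?_, f, hmor, ?_, ?_⟩
  · intro k
    refine Finset.sum_eq_zero fun i _ => LinearMap.ext fun x => ?_
    rw [LinearMap.comp_apply, hn, hn]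
    ext j
    · simp
    · simp; split_ifs <;> simp
    · simp; split_ifs <;> simp
  · rintro x - ⟨y, hy⟩
    obtain ⟨x', rfl⟩ := hfs y
    exact ⟨x', hfi (by rw [hf0, hy])⟩
  · intro y hy
    obtain ⟨x, rfl⟩ := hfs y
    refine ⟨x, hfi (by rw [hf0, hy, map_zero]), by simp⟩
end

section
/- Fix integers j ≥ 2, k ≥ 2 and n ≥ 1. Consider the Z₂-chain complex with underlying vector space of dimension 4n, with basis elements (i, a, b) for i ∈ {0, …, n−1} and a, b ∈ {0, 1}, and Z₂-linear differential D determined by: D(i, 0, b) contains the term (i − (j−1), 1, b) whenever i ≥ j − 1, D(i, a, 0) contains the term (i − (k−1), a, 1) whenever i ≥ k − 1 (D of a basis vector is the sum of the applicable terms, and zero if none applies; in particular D(i,1,1) = 0). Then D² = 0 and the cohomology ker D / im D has Z₂-dimension at least 4; if moreover j ≥ 3, k ≥ 3 and n ≥ 2, its dimension is at least 8. -/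
theorem stmt7_aux (j k n m : ℕ) (hj : m ≤ j - 1) (hk : m ≤ k - 1) (hn : m ≤ n)
    (D : ((Fin n × Fin 2 × Fin 2) → ZMod 2) →ₗ[ZMod 2]
        ((Fin n × Fin 2 × Fin 2) → ZMod 2))
    (hD : ∀ (v : (Fin n × Fin 2 × Fin 2) → ZMod 2) (i : Fin n) (a b : Fin 2),
      D v (i, a, b) =
        (if h : a = 1 ∧ (i : ℕ) + (j - 1) < n
          then v (⟨(i : ℕ) + (j - 1), h.2⟩, 0, b) else 0)
        + (if h : b = 1 ∧ (i : ℕ) + (k - 1) < n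
          then v (⟨(i : ℕ) + (k - 1), h.2⟩, a, 0) else 0)) :
    4 * m ≤ Module.finrank (ZMod 2)
        (LinearMap.ker D ⧸ (LinearMap.range D).comap (LinearMap.ker D).subtype) := by
  let φ : ((Fin n × Fin 2 × Fin 2) → ZMod 2) →ₗ[ZMod 2]
      ((Fin (n - m) → ZMod 2) × (Fin (n - m) → ZMod 2)) :=
    LinearMap.prod
      (LinearMap.funLeft (ZMod 2) (ZMod 2)
        (fun i : Fin (n - m) => ((⟨i + m, by omega⟩, 0, 0) : Fin n × Fin 2 × Fin 2)))
      (LinearMap.funLeft (ZMod 2) (ZMod 2)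
        (fun i : Fin (n - m) => ((⟨i, by omega⟩, 1, 1) : Fin n × Fin 2 × Fin 2)) ∘ₗ D)
  have hφ : LinearMap.ker φ ≤ LinearMap.ker D := by
    intro v hv
    have hv' : φ v = 0 := hv
    have h1 : ∀ (i : ℕ) (h : i < n), m ≤ i → v (⟨i, h⟩, 0, 0) = 0 := by
      intro i h hi
      have := congrFun (congrArg Prod.fst hv') ⟨i - m, by omega⟩
      simp only [φ, LinearMap.prod_apply, Function.prod, LinearMap.funLeft_apply] at this
      simpa [Nat.sub_add_cancel hi] using this
    have h2 : ∀ (i : ℕ) (h : i < n), i < n - m → D v (⟨i, h⟩, 1, 1) = 0 := by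
      intro i h hi
      have := congrFun (congrArg Prod.snd hv') ⟨i, hi⟩
      exact this
    rw [LinearMap.mem_ker]
    funext x
    obtain ⟨⟨i, hi⟩, a, b⟩ := x
    change _ = (0 : ZMod 2)
    by_cases hab : a = 1 ∧ b = 1
    · obtain ⟨rfl, rfl⟩ := hab
      by_cases him : i < n - m
      · exact h2 i hi him
      · rw [hD, dif_neg (by simp; omega), dif_neg (by simp; omega), add_zero]
    · rw [hD]
      have e1 : ∀ c : Fin 2, c ≠ 1 → c = 0 := by decide
      have A : (if h : a = 1 ∧ i + (j - 1) < n
          then v (⟨i + (j - 1), h.2⟩, 0, b) else 0) = 0 := by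
        split_ifs with h
        · have hb : b = 0 := e1 b (fun hb => hab ⟨h.1, hb⟩)
          subst hb
          exact h1 _ _ (by omega)
        · rfl
      have B : (if h : b = 1 ∧ i + (k - 1) < n
          then v (⟨i + (k - 1), h.2⟩, a, 0) else 0) = 0 := by
        split_ifs with h
        · have ha : a = 0 := e1 a (fun ha => hab ⟨ha, h.1⟩)
          subst ha
          exact h1 _ _ (by omega)
        · rfl
      exact (congrArg₂ (· + ·) A B).trans (add_zero 0)
  have r1 := LinearMap.finrank_range_add_finrank_ker φ
  have r2 := LinearMap.finrank_range_add_finrank_ker D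
  have r3 := Submodule.finrank_mono hφ
  have r4 := Submodule.finrank_le (LinearMap.range φ)
  have r5 := Submodule.finrank_quotient_add_finrank
    ((LinearMap.range D).comap (LinearMap.ker D).subtype)
  have r6 := Submodule.finrank_mono
    (Submodule.map_comap_le (LinearMap.ker D).subtype (LinearMap.range D))
  rw [Submodule.finrank_map_subtype_eq] at r6
  simp only [Module.finrank_prod, Module.finrank_fintype_fun_eq_card, Fintype.card_prod,
    Fintype.card_fin] at r1 r2 r4
  omega

/-- For `j, k ≥ 2`, `n ≥ 1`, the `ℤ/2`-complex with basis `(i, a, b)`,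
`i ∈ {0, …, n-1}`, `a, b ∈ {0, 1}`, and differential determined by
`D(i, 0, b) ∋ (i - (j-1), 1, b)` when `i ≥ j - 1` and `D(i, a, 0) ∋ (i - (k-1), a, 1)` when
`i ≥ k - 1` — written here in coordinates:
`(D v)(i, a, b) = [a = 1] · v(i + (j-1), 0, b) + [b = 1] · v(i + (k-1), a, 0)` (each term
present only when the shifted index is `< n`) — satisfies `D² = 0` and its cohomology
`ker D / im D` has dimension at least `4`; if moreover `j, k ≥ 3` and `n ≥ 2`, the dimension
is at least `8`. -/
theorem stmt7 (j k n : ℕ) (hj : 2 ≤ j) (hk : 2 ≤ k) (hn : 1 ≤ n)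
    (D : ((Fin n × Fin 2 × Fin 2) → ZMod 2) →ₗ[ZMod 2]
        ((Fin n × Fin 2 × Fin 2) → ZMod 2))
    (hD : ∀ (v : (Fin n × Fin 2 × Fin 2) → ZMod 2) (i : Fin n) (a b : Fin 2),
      D v (i, a, b) =
        (if h : a = 1 ∧ (i : ℕ) + (j - 1) < n
          then v (⟨(i : ℕ) + (j - 1), h.2⟩, 0, b) else 0)
        + (if h : b = 1 ∧ (i : ℕ) + (k - 1) < n
          then v (⟨(i : ℕ) + (k - 1), h.2⟩, a, 0) else 0)) :
    D ∘ₗ D = 0 ∧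
    4 ≤ Module.finrank (ZMod 2)
        (LinearMap.ker D ⧸ (LinearMap.range D).comap (LinearMap.ker D).subtype) ∧
    (3 ≤ j → 3 ≤ k → 2 ≤ n →
      8 ≤ Module.finrank (ZMod 2)
        (LinearMap.ker D ⧸ (LinearMap.range D).comap (LinearMap.ker D).subtype)) := by
  refine ⟨?_, ?_, ?_⟩
  · ext1 x
    ext1
    funext y
    obtain ⟨i, a, b⟩ := y
    simp only [LinearMap.comp_apply, LinearMap.zero_apply, Pi.zero_apply]
    generalize LinearMap.single (ZMod 2) (fun _ => ZMod 2) x 1 = v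
    have e : ∀ z : ZMod 2, z + z = 0 := by decide
    have e1 : ∀ c : Fin 2, c = 0 ∨ c = 1 := by decide
    have hc : (i : ℕ) + (j - 1) + (k - 1) = i + (k - 1) + (j - 1) := by omega
    simp only [hD]
    rcases e1 a with rfl | rfl <;> rcases e1 b with rfl | rfl
    · simp
    · simp
    · simp
    · by_cases h : (i : ℕ) + (j - 1) + (k - 1) < n
      · have h' := h
        rw [hc] at h'
        have h3 : (i : ℕ) + (j - 1) < n := by omega
        have h4 : (i : ℕ) + (k - 1) < n := by omega
        simp [h, h', h3, h4, hc, e]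
      · have h' := h
        rw [hc] at h'
        simp [h, h']
  · exact stmt7_aux j k n 1 (by omega) (by omega) hn D hD
  · intro h3 h4 h5
    exact stmt7_aux j k n 2 (by omega) (by omega) h5 D hD
end

section
/- Let (M', (m'_i)), (M, (m_i)) be finite-dimensional encoded right A_∞-modules over A, and (N', (n'_i)), (N, (n_i)) finite-dimensional encoded left A_∞-modules over A. Let f = (f_i)_{i ≥ 0} : M' → M and g = (g_i)_{i ≥ 0} : N' → N be strictly unital morphisms, i.e. sequences of Z₂-linear maps satisfying Σ_{i+j=k} f_i ∘ m'_j = Σ_{i+j=k} m_i ∘ f_j and Σ_{i+j=k} g_i ∘ n'_j = Σ_{i+j=k} n_i ∘ g_j for all k ≥ 0, and suppose f₀ induces an isomorphism ker m'₀/im m'₀ → ker m₀/im m₀ and g₀ induces an isomorphism ker n'₀/im n'₀ → ker n₀/im n₀. Then for every n ≥ 1 the Z₂-linear map h : (M' ⊗_A N')_n → (M ⊗_A N)_n, sending x ⊗ y in the summand of index i to Σ_{p+q ≤ i} f_p(x) ⊗ g_q(y) with the (p,q)-term placed in the summand of index i − p − q, is a chain map and induces an isomorphism on cohomology. -/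
open scoped TensorProduct

/-- Toeplitz operator attached to a sequence of linear maps. -/
noncomputable def toep {V W : Type*} [AddCommGroup V] [Module (ZMod 2) V]
    [AddCommGroup W] [Module (ZMod 2) W] (n : ℕ) (φ : ℕ → V →ₗ[ZMod 2] W) :
    (Fin n → V) →ₗ[ZMod 2] (Fin n → W) :=
  LinearMap.pi fun j => ∑ i : Fin n,
    if (j : ℕ) ≤ (i : ℕ) then φ ((i : ℕ) - (j : ℕ)) ∘ₗ LinearMap.proj i else 0

section
variable {U V W : Type*} [AddCommGroup V] [Module (ZMod 2) V]
    [AddCommGroup W] [Module (ZMod 2) W] [AddCommGroup U] [Module (ZMod 2) U]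

theorem toep_apply (n : ℕ) (φ : ℕ → V →ₗ[ZMod 2] W) (b : Fin n → V) (j : Fin n) :
    toep n φ b j = ∑ i : Fin n,
      if (j : ℕ) ≤ (i : ℕ) then φ ((i : ℕ) - (j : ℕ)) (b i) else 0 := by
  simp only [toep, LinearMap.pi_apply, LinearMap.sum_apply]
  refine Finset.sum_congr rfl fun i _ => ?_
  split_ifs <;> simp

theorem sum_interval (n : ℕ) (j l : Fin n) (hjl : (j : ℕ) ≤ l) (F : ℕ → W) :
    (∑ i : Fin n, if (j : ℕ) ≤ i ∧ (i : ℕ) ≤ l then F i else 0)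
      = ∑ i ∈ Finset.range ((l : ℕ) - j + 1), F (j + i) := by
  rw [Fin.sum_univ_eq_sum_range (fun i => if (j : ℕ) ≤ i ∧ i ≤ l then F i else 0) n,
    ← Finset.sum_filter]
  symm
  refine Finset.sum_bij (fun i _ => (j : ℕ) + i) ?_ ?_ ?_ ?_
  · intro i hi
    simp only [Finset.mem_range, Finset.mem_filter] at hi ⊢
    have := l.2
    omega
  · intro a _ b _ hab
    simpa using hab
  · intro b hb
    simp only [Finset.mem_range, Finset.mem_filter] at hb
    exact ⟨b - j, by simp only [Finset.mem_range]; omega, by omega⟩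
  · intros; rfl

theorem toep_comp (n : ℕ) (φ : ℕ → V →ₗ[ZMod 2] W) (ψ : ℕ → U →ₗ[ZMod 2] V) :
    toep n φ ∘ₗ toep n ψ
      = toep n (fun k => ∑ i ∈ Finset.range (k + 1), φ i ∘ₗ ψ (k - i)) := by
  refine LinearMap.ext fun b => funext fun j => ?_
  rw [LinearMap.comp_apply, toep_apply, toep_apply]
  have h1 : ∀ i : Fin n, (if (j : ℕ) ≤ i then φ ((i : ℕ) - j) (toep n ψ b i) else 0)
      = ∑ l : Fin n, if (j : ℕ) ≤ i ∧ (i : ℕ) ≤ l then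
          φ ((i : ℕ) - j) (ψ ((l : ℕ) - i) (b l)) else 0 := by
    intro i
    by_cases hji : (j : ℕ) ≤ i
    · simp only [hji, if_true, true_and, toep_apply, map_sum]
      refine Finset.sum_congr rfl fun l _ => ?_
      split_ifs <;> simp
    · simp [hji]
  rw [Finset.sum_congr rfl fun i _ => h1 i, Finset.sum_comm]
  refine Finset.sum_congr rfl fun l _ => ?_
  split_ifs with hjl
  · rw [sum_interval n j l hjl (fun i => φ (i - j) (ψ ((l : ℕ) - i) (b l)))]
    rw [LinearMap.sum_apply]
    refine Finset.sum_congr rfl fun i _ => ?_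
    simp only [LinearMap.comp_apply]
    rw [Nat.add_sub_cancel_left, Nat.sub_add_eq]
  · refine Finset.sum_eq_zero fun i _ => if_neg ?_
    omega

theorem toep_add (n : ℕ) (φ ψ : ℕ → V →ₗ[ZMod 2] W) :
    toep n (fun k => φ k + ψ k) = toep n φ + toep n ψ := by
  refine LinearMap.ext fun b => funext fun j => ?_
  simp only [LinearMap.add_apply, Pi.add_apply, toep_apply, ← Finset.sum_add_distrib]
  refine Finset.sum_congr rfl fun i _ => ?_
  split_ifs <;> simp

theorem toep_zero (n : ℕ) : toep n (fun _ => (0 : V →ₗ[ZMod 2] W)) = 0 := by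
  refine LinearMap.ext fun b => funext fun j => ?_
  simp [toep_apply]

theorem toep_inj (n : ℕ) (w : ℕ → V →ₗ[ZMod 2] V) (hw : w 0 = LinearMap.id) :
    Function.Injective (toep n w) := by
  rw [← LinearMap.ker_eq_bot, LinearMap.ker_eq_bot']
  intro b hb
  have key : ∀ k : ℕ, ∀ j : Fin n, n - (j : ℕ) ≤ k → b j = 0 := by
    intro k
    induction k with
    | zero => intro j hj; have := j.2; omega
    | succ k ih =>
      intro j hj
      have h := congrFun hb j
      rw [toep_apply, Finset.sum_eq_single j] at h
      · simpa [hw] using h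
      · intro i _ hij
        split_ifs with hji
        · have : (i : ℕ) ≠ j := fun h => hij (Fin.ext h)
          have := i.2
          rw [ih i (by omega), map_zero]
        · rfl
      · simp
  exact funext fun j => key n j (by omega)

theorem toep_exact [FiniteDimensional (ZMod 2) V] (n : ℕ) (e : ℕ → V →ₗ[ZMod 2] V)
    (he : toep n e ∘ₗ toep n e = 0) (s : V →ₗ[ZMod 2] V)
    (hs : ∀ x, e 0 (s x) + s (e 0 x) = x) (b : Fin n → V) (hb : toep n e b = 0) :
    b ∈ LinearMap.range (toep n e) := by
  let S : (Fin n → V) →ₗ[ZMod 2] (Fin n → V) := LinearMap.pi fun j => s ∘ₗ LinearMap.proj j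
  let Wt := toep n (fun k => e k ∘ₗ s + s ∘ₗ e k)
  have hW : ∀ b, Wt b = toep n e (S b) + S (toep n e b) := by
    intro b
    funext j
    simp only [Wt, S, Pi.add_apply, toep_apply, LinearMap.pi_apply, LinearMap.comp_apply,
      LinearMap.proj_apply, map_sum, ← Finset.sum_add_distrib]
    refine Finset.sum_congr rfl fun i _ => ?_
    split_ifs <;> simp
  have hinj : Function.Injective Wt := toep_inj n _ (LinearMap.ext fun x => by simpa using hs x)
  have hsurj : Function.Surjective Wt := LinearMap.surjective_of_injective hinj
  have hee : ∀ x, toep n e (toep n e x) = 0 := fun x => LinearMap.congr_fun he x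
  obtain ⟨c, hc⟩ := hsurj (S b)
  refine ⟨c, hinj ?_⟩
  have h1 : Wt (toep n e c) = toep n e (Wt c) := by
    simp [hW, hee]
  rw [h1, hc, hW b, hb, map_zero, add_zero]

theorem exists_homotopy (e : V →ₗ[ZMod 2] V) (hee : ∀ x, e (e x) = 0)
    (hex : ∀ x, e x = 0 → x ∈ LinearMap.range e) :
    ∃ s : V →ₗ[ZMod 2] V, ∀ x, e (s x) + s (e x) = x := by
  obtain ⟨σ, hσ⟩ := e.rangeRestrict.exists_rightInverse_of_surjective e.range_rangeRestrict
  obtain ⟨g, hg⟩ := LinearMap.exists_extend σ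
  have hge : ∀ x, e (g (e x)) = e x := by
    intro x
    have h1 : g (e x) = σ ⟨e x, x, rfl⟩ := by rw [← hg]; rfl
    rw [h1]
    exact congrArg Subtype.val (LinearMap.congr_fun hσ ⟨e x, x, rfl⟩)
  refine ⟨g ∘ₗ (LinearMap.id - g ∘ₗ e), fun x => ?_⟩
  have h2 : e (x - g (e x)) = 0 := by rw [map_sub, hge, sub_self]
  obtain ⟨y, hy⟩ := hex _ h2
  simp only [LinearMap.comp_apply, LinearMap.sub_apply, LinearMap.id_apply, hee, map_zero,
    sub_zero]
  rw [← hy, hge, hy, sub_add_cancel]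

/-- quasi-isomorphism -/
def QI (d' : V →ₗ[ZMod 2] V) (d : W →ₗ[ZMod 2] W) (φ : V →ₗ[ZMod 2] W) : Prop :=
  (∀ b, d' b = 0 → φ b ∈ LinearMap.range d → b ∈ LinearMap.range d') ∧
  (∀ c, d c = 0 → ∃ b, d' b = 0 ∧ c - φ b ∈ LinearMap.range d)

theorem QI.comp {d₁ : U →ₗ[ZMod 2] U} {d₂ : V →ₗ[ZMod 2] V} {d₃ : W →ₗ[ZMod 2] W}
    {φ : U →ₗ[ZMod 2] V} {ψ : V →ₗ[ZMod 2] W} (h1 : QI d₁ d₂ φ) (h2 : QI d₂ d₃ ψ)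
    (c1 : d₂ ∘ₗ φ = φ ∘ₗ d₁) (c2 : d₃ ∘ₗ ψ = ψ ∘ₗ d₂) : QI d₁ d₃ (ψ ∘ₗ φ) := by
  have c1' : ∀ x, d₂ (φ x) = φ (d₁ x) := LinearMap.congr_fun c1
  have c2' : ∀ x, d₃ (ψ x) = ψ (d₂ x) := LinearMap.congr_fun c2
  constructor
  · intro b hb hr
    exact h1.1 b hb (h2.1 _ (by rw [c1', hb, map_zero]) hr)
  · intro c hc
    obtain ⟨b, hb, w, hw⟩ := h2.2 c hc
    obtain ⟨a, ha, z, hz⟩ := h1.2 b hb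
    refine ⟨a, ha, w + ψ z, ?_⟩
    rw [map_add, c2', hz, hw, LinearMap.comp_apply, map_sub]
    abel

/-- mapping cone -/
def cone (d' : V →ₗ[ZMod 2] V) (d : W →ₗ[ZMod 2] W) (φ : V →ₗ[ZMod 2] W) :
    (V × W) →ₗ[ZMod 2] (V × W) :=
  (d' ∘ₗ LinearMap.fst _ _ _).prod (φ ∘ₗ LinearMap.fst _ _ _ + d ∘ₗ LinearMap.snd _ _ _)

theorem cone_apply (d' : V →ₗ[ZMod 2] V) (d : W →ₗ[ZMod 2] W) (φ : V →ₗ[ZMod 2] W) (x : V × W) :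
    cone d' d φ x = (d' x.1, φ x.1 + d x.2) := rfl

theorem two_zero (x : W) : x + x = 0 := by
  rw [← two_smul (ZMod 2) x, show (2 : ZMod 2) = 0 from rfl, zero_smul]

theorem eq_of_add_zero {x y : W} (h : x + y = 0) : x = y := by
  rw [eq_neg_of_add_eq_zero_left h]
  exact neg_eq_of_add_eq_zero_left (two_zero y)

theorem cone_exact {d' : V →ₗ[ZMod 2] V} {d : W →ₗ[ZMod 2] W} {φ : V →ₗ[ZMod 2] W}
    (hq : QI d' d φ) (hc : ∀ x, φ (d' x) = d (φ x)) (x : V × W) (hx : cone d' d φ x = 0) :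
    x ∈ LinearMap.range (cone d' d φ) := by
  obtain ⟨x, y⟩ := x
  rw [cone_apply, Prod.mk_eq_zero] at hx
  obtain ⟨h1, h2⟩ := hx
  obtain ⟨x1, hx1⟩ := hq.1 x h1 ⟨y, (eq_of_add_zero h2).symm⟩
  obtain ⟨z, hz, w, hw⟩ := hq.2 (φ x1 + y) (by rw [map_add, ← hc, hx1]; exact h2)
  refine ⟨(x1 + z, w), ?_⟩
  rw [cone_apply, Prod.mk.injEq]
  refine ⟨by simp only [map_add, hx1, hz, add_zero], ?_⟩
  simp only [map_add, hw]
  have := two_zero (φ x1)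
  calc φ x1 + φ z + (φ x1 + y - φ z) = (φ x1 + φ x1) + y := by abel
    _ = y := by rw [this, zero_add]

theorem QI_of_cone_exact {d' : V →ₗ[ZMod 2] V} {d : W →ₗ[ZMod 2] W} {φ : V →ₗ[ZMod 2] W}
    (hx : ∀ x, cone d' d φ x = 0 → x ∈ LinearMap.range (cone d' d φ)) : QI d' d φ := by
  constructor
  · rintro x h1 ⟨y, hy⟩
    obtain ⟨z, hz⟩ := hx (x, y) (by rw [cone_apply]; simp only [h1, hy, two_zero]; rfl)
    exact ⟨z.1, congrArg Prod.fst hz⟩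
  · intro y hy
    obtain ⟨z, hz⟩ := hx (0, y) (by rw [cone_apply]; simp only [hy, map_zero, add_zero]; rfl)
    rw [cone_apply, Prod.mk.injEq] at hz
    exact ⟨z.1, hz.1, z.2, by rw [← hz.2]; abel⟩

/-- cone homotopy data -/
def Hot (d' : V →ₗ[ZMod 2] V) (d : W →ₗ[ZMod 2] W) (φ : V →ₗ[ZMod 2] W)
    (r : V →ₗ[ZMod 2] V) (t : W →ₗ[ZMod 2] V) (u : V →ₗ[ZMod 2] W) (v : W →ₗ[ZMod 2] W) : Prop :=
  (∀ x, d' (r x) + r (d' x) + t (φ x) = x) ∧ (∀ y, d' (t y) + t (d y) = 0) ∧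
  (∀ x, φ (r x) + d (u x) + u (d' x) + v (φ x) = 0) ∧
  (∀ y, φ (t y) + d (v y) + v (d y) = y)

theorem QI.exists_hot {d' : V →ₗ[ZMod 2] V} {d : W →ₗ[ZMod 2] W} {φ : V →ₗ[ZMod 2] W}
    (hq : QI d' d φ) (hc : ∀ x, φ (d' x) = d (φ x)) (h1 : ∀ x, d' (d' x) = 0)
    (h2 : ∀ x, d (d x) = 0) : ∃ r t u v, Hot d' d φ r t u v := by
  obtain ⟨s, hs⟩ := exists_homotopy (cone d' d φ) (fun x => by
    simp only [cone_apply, h1, map_add, h2, hc, add_zero, two_zero]; rfl) (cone_exact hq hc)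
  refine ⟨LinearMap.fst _ _ _ ∘ₗ s ∘ₗ LinearMap.inl _ _ _,
    LinearMap.fst _ _ _ ∘ₗ s ∘ₗ LinearMap.inr _ _ _,
    LinearMap.snd _ _ _ ∘ₗ s ∘ₗ LinearMap.inl _ _ _,
    LinearMap.snd _ _ _ ∘ₗ s ∘ₗ LinearMap.inr _ _ _, ?_⟩
  have hsp : ∀ a b, s (a, b) = s (a, 0) + s (0, b) := fun a b => by
    rw [← map_add]; simp
  have hx : ∀ x : V, _ := fun x => hs (x, 0)
  have hy : ∀ y : W, _ := fun y => hs (0, y)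
  simp only [cone_apply, map_zero, add_zero, zero_add] at hx hy
  refine ⟨fun x => ?_, fun y => ?_, fun x => ?_, fun y => ?_⟩
  · have := congrArg Prod.fst (hx x)
    rw [hsp (d' x) (φ x)] at this
    simp only [Prod.fst_add] at this
    simpa [add_assoc] using this
  · have := congrArg Prod.fst (hy y)
    simpa [add_assoc] using this
  · have := congrArg Prod.snd (hx x)
    rw [hsp (d' x) (φ x)] at this
    simp only [Prod.snd_add] at this
    simpa [add_assoc] using this
  · have := congrArg Prod.snd (hy y)
    simpa [add_assoc] using this

theorem toep_cone (n : ℕ) (d' : ℕ → V →ₗ[ZMod 2] V) (d : ℕ → W →ₗ[ZMod 2] W)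
    (φ : ℕ → V →ₗ[ZMod 2] W) (b : Fin n → V × W) :
    toep n (fun k => cone (d' k) (d k) (φ k)) b = fun j =>
      (toep n d' (fun i => (b i).1) j,
        toep n φ (fun i => (b i).1) j + toep n d (fun i => (b i).2) j) := by
  funext j
  simp only [toep_apply]
  refine Prod.ext ?_ ?_
  · simp only [Prod.fst_sum]
    refine Finset.sum_congr rfl fun i _ => ?_
    split_ifs <;> rfl
  · simp only [Prod.snd_sum, ← Finset.sum_add_distrib]
    refine Finset.sum_congr rfl fun i _ => ?_
    split_ifs
    · rfl
    · simp

theorem toep_QI [FiniteDimensional (ZMod 2) V] [FiniteDimensional (ZMod 2) W] (n : ℕ)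
    (d' : ℕ → V →ₗ[ZMod 2] V) (d : ℕ → W →ₗ[ZMod 2] W) (φ : ℕ → V →ₗ[ZMod 2] W)
    (h1 : toep n d' ∘ₗ toep n d' = 0) (h2 : toep n d ∘ₗ toep n d = 0)
    (hc : toep n d ∘ₗ toep n φ = toep n φ ∘ₗ toep n d')
    {r t u v} (H : Hot (d' 0) (d 0) (φ 0) r t u v) :
    QI (toep n d') (toep n d) (toep n φ) := by
  have h1' : ∀ x, toep n d' (toep n d' x) = 0 := LinearMap.congr_fun h1
  have h2' : ∀ x, toep n d (toep n d x) = 0 := LinearMap.congr_fun h2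
  have hc' : ∀ x, toep n d (toep n φ x) = toep n φ (toep n d' x) := LinearMap.congr_fun hc
  have hee : toep n (fun k => cone (d' k) (d k) (φ k)) ∘ₗ
      toep n (fun k => cone (d' k) (d k) (φ k)) = 0 := by
    refine LinearMap.ext fun b => ?_
    rw [LinearMap.comp_apply, toep_cone, toep_cone]
    funext j
    simp only
    have e1 := h1' (fun i => (b i).1)
    have e2 := h2' (fun i => (b i).2)
    have e3 := hc' (fun i => (b i).1)
    have e4 : toep n d (fun i => toep n φ (fun i => (b i).1) i + toep n d (fun i => (b i).2) i)
      = toep n φ (toep n d' (fun i => (b i).1)) := by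
      rw [← e3, ← add_zero (toep n d (toep n φ _)), ← e2, ← map_add]; rfl
    rw [e4]
    change (toep n d' (toep n d' _) j, toep n φ (toep n d' _) j + _) = _
    rw [e1, two_zero]; rfl
  let s : (V × W) →ₗ[ZMod 2] (V × W) :=
    (r ∘ₗ LinearMap.fst _ _ _ + t ∘ₗ LinearMap.snd _ _ _).prod
      (u ∘ₗ LinearMap.fst _ _ _ + v ∘ₗ LinearMap.snd _ _ _)
  have hs : ∀ x, cone (d' 0) (d 0) (φ 0) (s x) + s (cone (d' 0) (d 0) (φ 0) x) = x := by
    rintro ⟨x, y⟩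
    obtain ⟨H1, H2, H3, H4⟩ := H
    have sa : ∀ a b, s (a, b) = (r a + t b, u a + v b) := fun _ _ => rfl
    rw [sa, cone_apply, cone_apply, sa, Prod.mk_add_mk, Prod.mk.injEq]
    simp only [map_add]
    constructor
    · refine Eq.trans ?_ (add_zero x)
      rw [← H2 y]
      nth_rewrite 4 [← H1 x]
      abel
    · refine Eq.trans ?_ (zero_add y)
      rw [← H3 x]
      nth_rewrite 4 [← H4 y]
      abel
  have hex := toep_exact n _ hee s hs
  refine QI_of_cone_exact fun x hx => ?_
  rw [cone_apply, Prod.mk_eq_zero] at hx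
  obtain ⟨c, hc⟩ := hex (fun i => (x.1 i, x.2 i)) (by
    rw [toep_cone]
    funext j
    exact Prod.ext (congrFun hx.1 j) (congrFun hx.2 j))
  rw [toep_cone] at hc
  refine ⟨(fun i => (c i).1, fun i => (c i).2), ?_⟩
  rw [cone_apply]
  refine Prod.ext (funext fun j => ?_) (funext fun j => ?_)
  · exact congrArg Prod.fst (congrFun hc j)
  · exact congrArg Prod.snd (congrFun hc j)

end

section
variable {P Q R X Y Z : Type*} [AddCommGroup P] [Module (ZMod 2) P]
    [AddCommGroup Q] [Module (ZMod 2) Q] [AddCommGroup R] [Module (ZMod 2) R]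
    [AddCommGroup X] [Module (ZMod 2) X] [AddCommGroup Y] [Module (ZMod 2) Y]
    [AddCommGroup Z] [Module (ZMod 2) Z]

/-- left factor operators -/
noncomputable def tl (Y : Type*) [AddCommGroup Y] [Module (ZMod 2) Y] (n : ℕ)
    (a : ℕ → P →ₗ[ZMod 2] Q) :=
  toep n (fun k => TensorProduct.map (a k) (LinearMap.id : Y →ₗ[ZMod 2] Y))

/-- right factor operators -/
noncomputable def tr (P : Type*) [AddCommGroup P] [Module (ZMod 2) P] (n : ℕ)
    (a : ℕ → X →ₗ[ZMod 2] Y) :=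
  toep n (fun k => TensorProduct.map (LinearMap.id : P →ₗ[ZMod 2] P) (a k))

theorem tl_tr (n : ℕ) (a : ℕ → P →ₗ[ZMod 2] Q) (b : ℕ → X →ₗ[ZMod 2] Y) :
    tl Y n a ∘ₗ tr P n b = toep n (fun k => ∑ i ∈ Finset.range (k + 1),
      TensorProduct.map (a i) (b (k - i))) := by
  rw [tl, tr, toep_comp]
  simp only [← TensorProduct.map_comp, LinearMap.comp_id, LinearMap.id_comp]

theorem tl_tr_comm (n : ℕ) (a : ℕ → P →ₗ[ZMod 2] Q) (b : ℕ → X →ₗ[ZMod 2] Y) :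
    tl Y n a ∘ₗ tr P n b = tr Q n b ∘ₗ tl X n a := by
  rw [tl_tr, tl, tr, toep_comp]
  simp only [← TensorProduct.map_comp, LinearMap.comp_id, LinearMap.id_comp]
  congr 1
  funext k
  rw [← Finset.sum_range_reflect]
  refine Finset.sum_congr rfl fun i hi => ?_
  rw [Finset.mem_range] at hi
  rw [show k + 1 - 1 - i = k - i by omega, show k - (k - i) = i by omega]

theorem tl_tl (n : ℕ) (a : ℕ → Q →ₗ[ZMod 2] R) (b : ℕ → P →ₗ[ZMod 2] Q) :
    tl Y n a ∘ₗ tl Y n b = tl Y n (fun k => ∑ i ∈ Finset.range (k + 1), a i ∘ₗ b (k - i)) := by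
  rw [tl, tl, toep_comp, tl]
  congr 1
  funext k
  refine TensorProduct.ext' fun x y => ?_
  simp [LinearMap.sum_apply, TensorProduct.sum_tmul]

theorem tr_tr (n : ℕ) (a : ℕ → Y →ₗ[ZMod 2] Z) (b : ℕ → X →ₗ[ZMod 2] Y) :
    tr P n a ∘ₗ tr P n b = tr P n (fun k => ∑ i ∈ Finset.range (k + 1), a i ∘ₗ b (k - i)) := by
  rw [tr, tr, toep_comp, tr]
  congr 1
  funext k
  refine TensorProduct.ext' fun x y => ?_
  simp [LinearMap.sum_apply, TensorProduct.tmul_sum]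

theorem tl_zero (n : ℕ) : tl Y n (fun _ => (0 : P →ₗ[ZMod 2] Q)) = 0 := by
  rw [tl]; simp only [TensorProduct.map_zero_left]; exact toep_zero n

theorem tr_zero (n : ℕ) : tr P n (fun _ => (0 : X →ₗ[ZMod 2] Y)) = 0 := by
  rw [tr]; simp only [TensorProduct.map_zero_right]; exact toep_zero n

/-- the total coefficient -/
noncomputable def tot (a : ℕ → P →ₗ[ZMod 2] P) (b : ℕ → X →ₗ[ZMod 2] X) (k : ℕ) :
    TensorProduct (ZMod 2) P X →ₗ[ZMod 2] TensorProduct (ZMod 2) P X :=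
  TensorProduct.map (a k) LinearMap.id + TensorProduct.map LinearMap.id (b k)

theorem toep_tot (n : ℕ) (a : ℕ → P →ₗ[ZMod 2] P) (b : ℕ → X →ₗ[ZMod 2] X) :
    toep n (tot a b) = tl X n a + tr P n b := toep_add n _ _

theorem tot_sq (n : ℕ) (a : ℕ → P →ₗ[ZMod 2] P) (b : ℕ → X →ₗ[ZMod 2] X)
    (ha : ∀ k : ℕ, ∑ i ∈ Finset.range (k + 1), a i ∘ₗ a (k - i) = 0)
    (hb : ∀ k : ℕ, ∑ i ∈ Finset.range (k + 1), b i ∘ₗ b (k - i) = 0) :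
    toep n (tot a b) ∘ₗ toep n (tot a b) = 0 := by
  rw [toep_tot, LinearMap.add_comp, LinearMap.comp_add, LinearMap.comp_add, tl_tl, tr_tr,
    tl_tr_comm]
  simp only [ha, hb, tl_zero, tr_zero, zero_add, add_zero]
  exact two_zero _

theorem tot_tl (n : ℕ) (a' : ℕ → P →ₗ[ZMod 2] P) (a : ℕ → Q →ₗ[ZMod 2] Q)
    (b : ℕ → X →ₗ[ZMod 2] X) (f : ℕ → P →ₗ[ZMod 2] Q)
    (hf : ∀ k : ℕ, ∑ i ∈ Finset.range (k + 1), f i ∘ₗ a' (k - i)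
        = ∑ i ∈ Finset.range (k + 1), a i ∘ₗ f (k - i)) :
    toep n (tot a b) ∘ₗ tl X n f = tl X n f ∘ₗ toep n (tot a' b) := by
  rw [toep_tot, toep_tot, LinearMap.add_comp, LinearMap.comp_add, tl_tl, tl_tl, tl_tr_comm]
  simp only [hf]

theorem tot_tr (n : ℕ) (a : ℕ → P →ₗ[ZMod 2] P)
    (b' : ℕ → X →ₗ[ZMod 2] X) (b : ℕ → Y →ₗ[ZMod 2] Y) (g : ℕ → X →ₗ[ZMod 2] Y)
    (hg : ∀ k : ℕ, ∑ i ∈ Finset.range (k + 1), g i ∘ₗ b' (k - i)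
        = ∑ i ∈ Finset.range (k + 1), b i ∘ₗ g (k - i)) :
    toep n (tot a b) ∘ₗ tr P n g = tr P n g ∘ₗ toep n (tot a b') := by
  rw [toep_tot, toep_tot, LinearMap.add_comp, LinearMap.comp_add, tr_tr, tr_tr, tl_tr_comm]
  simp only [hg]

theorem hot_l {a' : ℕ → P →ₗ[ZMod 2] P} {a : ℕ → Q →ₗ[ZMod 2] Q} (b : ℕ → X →ₗ[ZMod 2] X)
    {f : P →ₗ[ZMod 2] Q} {r t u v} (H : Hot (a' 0) (a 0) f r t u v) :
    Hot (tot a' b 0) (tot a b 0) (TensorProduct.map f (LinearMap.id : X →ₗ[ZMod 2] X))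
      (TensorProduct.map r LinearMap.id) (TensorProduct.map t LinearMap.id)
      (TensorProduct.map u LinearMap.id) (TensorProduct.map v LinearMap.id) := by
  obtain ⟨H1, H2, H3, H4⟩ := H
  refine ⟨fun z => ?_, fun z => ?_, fun z => ?_, fun z => ?_⟩ <;>
    induction z using TensorProduct.induction_on with
    | zero => simp
    | add z w hz hw => 
      first
      | (refine Eq.trans ?_ (congrArg₂ (· + ·) hz hw); simp only [map_add]; abel)
      | (refine Eq.trans (Eq.trans ?_ (congrArg₂ (· + ·) hz hw)) (add_zero _)
         simp only [map_add]; abel)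
    | tmul x y => 
      simp only [tot, LinearMap.add_apply, TensorProduct.map_tmul, LinearMap.id_apply, map_add]
      first
      | (have h2 := two_zero (r x ⊗ₜ[ZMod 2] (b 0 y))
         have h1 := congrArg (fun x => x ⊗ₜ[ZMod 2] y) (H1 x)
         simp only [TensorProduct.add_tmul] at h1
         linear_combination (norm := abel) h1 + h2)
      | (have h2 := two_zero (t x ⊗ₜ[ZMod 2] (b 0 y))
         have h1 := congrArg (fun x => x ⊗ₜ[ZMod 2] y) (H2 x)
         simp only [TensorProduct.add_tmul, TensorProduct.zero_tmul] at h1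
         linear_combination (norm := abel) h1 + h2)
      | (have h2 := two_zero (u x ⊗ₜ[ZMod 2] (b 0 y))
         have h1 := congrArg (fun x => x ⊗ₜ[ZMod 2] y) (H3 x)
         simp only [TensorProduct.add_tmul, TensorProduct.zero_tmul] at h1
         linear_combination (norm := abel) h1 + h2)
      | (have h2 := two_zero (v x ⊗ₜ[ZMod 2] (b 0 y))
         have h1 := congrArg (fun x => x ⊗ₜ[ZMod 2] y) (H4 x)
         simp only [TensorProduct.add_tmul] at h1
         linear_combination (norm := abel) h1 + h2)

theorem hot_r (a : ℕ → P →ₗ[ZMod 2] P) {b' : ℕ → X →ₗ[ZMod 2] X} {b : ℕ → Y →ₗ[ZMod 2] Y}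
    {g : X →ₗ[ZMod 2] Y} {r t u v} (H : Hot (b' 0) (b 0) g r t u v) :
    Hot (tot a b' 0) (tot a b 0) (TensorProduct.map (LinearMap.id : P →ₗ[ZMod 2] P) g)
      (TensorProduct.map LinearMap.id r) (TensorProduct.map LinearMap.id t)
      (TensorProduct.map LinearMap.id u) (TensorProduct.map LinearMap.id v) := by
  obtain ⟨H1, H2, H3, H4⟩ := H
  refine ⟨fun z => ?_, fun z => ?_, fun z => ?_, fun z => ?_⟩ <;>
    induction z using TensorProduct.induction_on with
    | zero => simp
    | add z w hz hw => 
      first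
      | (refine Eq.trans ?_ (congrArg₂ (· + ·) hz hw); simp only [map_add]; abel)
      | (refine Eq.trans (Eq.trans ?_ (congrArg₂ (· + ·) hz hw)) (add_zero _)
         simp only [map_add]; abel)
    | tmul y x => 
      simp only [tot, LinearMap.add_apply, TensorProduct.map_tmul, LinearMap.id_apply, map_add]
      first
      | (have h2 := two_zero ((a 0 y) ⊗ₜ[ZMod 2] r x)
         have h1 := congrArg (fun x => y ⊗ₜ[ZMod 2] x) (H1 x)
         simp only [TensorProduct.tmul_add] at h1
         linear_combination (norm := abel) h1 + h2)
      | (have h2 := two_zero ((a 0 y) ⊗ₜ[ZMod 2] t x)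
         have h1 := congrArg (fun x => y ⊗ₜ[ZMod 2] x) (H2 x)
         simp only [TensorProduct.tmul_add, TensorProduct.tmul_zero] at h1
         linear_combination (norm := abel) h1 + h2)
      | (have h2 := two_zero ((a 0 y) ⊗ₜ[ZMod 2] u x)
         have h1 := congrArg (fun x => y ⊗ₜ[ZMod 2] x) (H3 x)
         simp only [TensorProduct.tmul_add, TensorProduct.tmul_zero] at h1
         linear_combination (norm := abel) h1 + h2)
      | (have h2 := two_zero ((a 0 y) ⊗ₜ[ZMod 2] v x)
         have h1 := congrArg (fun x => y ⊗ₜ[ZMod 2] x) (H4 x)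
         simp only [TensorProduct.tmul_add] at h1
         linear_combination (norm := abel) h1 + h2)

end


/-- Quasi-isomorphism invariance of truncated bar complexes.  Let
`(M', m')`, `(M, m)` be finite-dimensional encoded right `A_∞`-modules and `(N', n')`,
`(N, nn)` finite-dimensional encoded left `A_∞`-modules over `A = ℤ/2[ε]/(ε²)`, and let
`f : M' → M`, `g : N' → N` be strictly unital morphisms (sequences of linear maps satisfying
`∑_{i+j=k} f_i ∘ m'_j = ∑_{i+j=k} m_i ∘ f_j`, etc.) with `f₀`, `g₀` quasi-isomorphisms.
Then for every `n ≥ 1` the map `h : (M' ⊗_A N')_n → (M ⊗_A N)_n`, sending `x ⊗ y` in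
summand `i` to `∑_{p+q ≤ i} f_p x ⊗ g_q y` placed in summand `i - p - q`, is a chain map
and induces an isomorphism on cohomology. -/
theorem stmt9 {M' M N' N : Type*}
    [AddCommGroup M'] [Module (ZMod 2) M'] [FiniteDimensional (ZMod 2) M']
    [AddCommGroup M] [Module (ZMod 2) M] [FiniteDimensional (ZMod 2) M]
    [AddCommGroup N'] [Module (ZMod 2) N'] [FiniteDimensional (ZMod 2) N']
    [AddCommGroup N] [Module (ZMod 2) N] [FiniteDimensional (ZMod 2) N]
    (m' : ℕ → M' →ₗ[ZMod 2] M') (m : ℕ → M →ₗ[ZMod 2] M)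
    (n' : ℕ → N' →ₗ[ZMod 2] N') (nn : ℕ → N →ₗ[ZMod 2] N)
    (hm' : ∀ k : ℕ, ∑ i ∈ Finset.range (k + 1), m' i ∘ₗ m' (k - i) = 0)
    (hm : ∀ k : ℕ, ∑ i ∈ Finset.range (k + 1), m i ∘ₗ m (k - i) = 0)
    (hn' : ∀ k : ℕ, ∑ i ∈ Finset.range (k + 1), n' i ∘ₗ n' (k - i) = 0)
    (hnn : ∀ k : ℕ, ∑ i ∈ Finset.range (k + 1), nn i ∘ₗ nn (k - i) = 0)
    (f : ℕ → M' →ₗ[ZMod 2] M) (g : ℕ → N' →ₗ[ZMod 2] N)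
    (hf : ∀ k : ℕ, ∑ i ∈ Finset.range (k + 1), f i ∘ₗ m' (k - i)
        = ∑ i ∈ Finset.range (k + 1), m i ∘ₗ f (k - i))
    (hg : ∀ k : ℕ, ∑ i ∈ Finset.range (k + 1), g i ∘ₗ n' (k - i)
        = ∑ i ∈ Finset.range (k + 1), nn i ∘ₗ g (k - i))
    -- `f 0` is a quasi-isomorphism:
    (hf0inj : ∀ x, m' 0 x = 0 → f 0 x ∈ LinearMap.range (m 0) →
        x ∈ LinearMap.range (m' 0))
    (hf0surj : ∀ y, m 0 y = 0 → ∃ x, m' 0 x = 0 ∧ y - f 0 x ∈ LinearMap.range (m 0))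
    -- `g 0` is a quasi-isomorphism:
    (hg0inj : ∀ x, n' 0 x = 0 → g 0 x ∈ LinearMap.range (nn 0) →
        x ∈ LinearMap.range (n' 0))
    (hg0surj : ∀ y, nn 0 y = 0 → ∃ x, n' 0 x = 0 ∧ y - g 0 x ∈ LinearMap.range (nn 0))
    (n : ℕ) (hn1 : 1 ≤ n)
    -- the two truncated bar differentials:
    (D' : (Fin n → TensorProduct (ZMod 2) M' N') →ₗ[ZMod 2]
        (Fin n → TensorProduct (ZMod 2) M' N'))
    (hD' : ∀ (b : Fin n → TensorProduct (ZMod 2) M' N') (j : Fin n),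
      D' b j = ∑ i : Fin n, if (j : ℕ) ≤ (i : ℕ) then
        TensorProduct.map (m' ((i : ℕ) - (j : ℕ))) LinearMap.id (b i)
          + TensorProduct.map LinearMap.id (n' ((i : ℕ) - (j : ℕ))) (b i) else 0)
    (D : (Fin n → TensorProduct (ZMod 2) M N) →ₗ[ZMod 2]
        (Fin n → TensorProduct (ZMod 2) M N))
    (hD : ∀ (b : Fin n → TensorProduct (ZMod 2) M N) (j : Fin n),
      D b j = ∑ i : Fin n, if (j : ℕ) ≤ (i : ℕ) then
        TensorProduct.map (m ((i : ℕ) - (j : ℕ))) LinearMap.id (b i)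
          + TensorProduct.map LinearMap.id (nn ((i : ℕ) - (j : ℕ))) (b i) else 0)
    -- the map `h`:
    (h : (Fin n → TensorProduct (ZMod 2) M' N') →ₗ[ZMod 2]
        (Fin n → TensorProduct (ZMod 2) M N))
    (hh : ∀ (b : Fin n → TensorProduct (ZMod 2) M' N') (j : Fin n),
      h b j = ∑ i : Fin n, if (j : ℕ) ≤ (i : ℕ) then
        ∑ p ∈ Finset.range (((i : ℕ) - (j : ℕ)) + 1),
          TensorProduct.map (f p) (g (((i : ℕ) - (j : ℕ)) - p)) (b i) else 0) :
    D ∘ₗ h = h ∘ₗ D' ∧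
    (∀ b, D' b = 0 → h b ∈ LinearMap.range D → b ∈ LinearMap.range D') ∧
    (∀ c, D c = 0 → ∃ b, D' b = 0 ∧ c - h b ∈ LinearMap.range D) := by
  have eD' : D' = toep n (tot m' n') :=
    LinearMap.ext fun b => funext fun j => (hD' b j).trans (toep_apply n (tot m' n') b j).symm
  have eD : D = toep n (tot m nn) :=
    LinearMap.ext fun b => funext fun j => (hD b j).trans (toep_apply n (tot m nn) b j).symm
  have eh : h = tl N n f ∘ₗ tr M' n g := by
    rw [tl_tr]
    refine LinearMap.ext fun b => funext fun j => ?_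
    rw [hh, toep_apply]
    simp only [LinearMap.sum_apply]
  have c1 : toep n (tot m' nn) ∘ₗ tr M' n g = tr M' n g ∘ₗ toep n (tot m' n') :=
    tot_tr n m' n' nn g hg
  have c2 : toep n (tot m nn) ∘ₗ tl N n f = tl N n f ∘ₗ toep n (tot m' nn) :=
    tot_tl n m' m nn f hf
  have s1 := tot_sq n m' n' hm' hn'
  have s2 := tot_sq n m' nn hm' hnn
  have s3 := tot_sq n m nn hm hnn
  obtain ⟨r, t, u, v, H⟩ := QI.exists_hot (d' := m' 0) (d := m 0) (φ := f 0) ⟨hf0inj, hf0surj⟩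
    (fun x => by simpa using LinearMap.congr_fun (hf 0) x)
    (fun x => by simpa using LinearMap.congr_fun (hm' 0) x)
    (fun x => by simpa using LinearMap.congr_fun (hm 0) x)
  obtain ⟨r', t', u', v', H'⟩ := QI.exists_hot (d' := n' 0) (d := nn 0) (φ := g 0)
    ⟨hg0inj, hg0surj⟩
    (fun x => by simpa using LinearMap.congr_fun (hg 0) x)
    (fun x => by simpa using LinearMap.congr_fun (hn' 0) x)
    (fun x => by simpa using LinearMap.congr_fun (hnn 0) x)
  have q1 : QI (toep n (tot m' n')) (toep n (tot m' nn)) (tr M' n g) :=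
    toep_QI n _ _ _ s1 s2 c1 (hot_r m' H')
  have q2 : QI (toep n (tot m' nn)) (toep n (tot m nn)) (tl N n f) :=
    toep_QI n _ _ _ s2 s3 c2 (hot_l nn H)
  subst eD' eD eh
  refine ⟨?_, QI.comp q1 q2 c1 c2⟩
  rw [← LinearMap.comp_assoc, c2, LinearMap.comp_assoc, c1, LinearMap.comp_assoc]
end
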